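/- Let v be a valuation on a field F with valuation ring A, maximal ideal M, unit group U, and residue field k of characteristic not 2. Let T₀ be a subgroup of kˣ containing all nonzero squares of k such that −1 ∉ T₀ and −1 ∈ T₀ + T₀, and set T = (Fˣ)² · π⁻¹(T₀), where π : U → kˣ is the residue map. Then −1 ∉ T and −1 ∈ T + T, i.e. T has level 2. -/

import Mathlib

/-- The subset of `F` corresponding to a subgroup of `Fˣ`. -/
def coeSet {F : Type*} [Field F] (T : Subgroup Fˣ) : Set F :=
  (fun u : Fˣ => (u : F)) '' (T : Set Fˣ)

/-- `T + aT = { t₁ + a·t₂ : t₁, t₂ ∈ T ∪ {0}, t₁ + a·t₂ ≠ 0 }`. -/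
def sumSet {F : Type*} [Field F] (T : Set F) (a : F) : Set F :=
  {x | x ≠ 0 ∧ ∃ t₁ ∈ T ∪ {(0 : F)}, ∃ t₂ ∈ T ∪ {(0 : F)}, x = t₁ + a * t₂}

/-- The coset `aT`. -/
def scaleSet {F : Type*} [Field F] (a : F) (T : Set F) : Set F :=
  {x | ∃ t ∈ T, x = a * t}

/-- `F` is `T`-rigid: `T + aT ⊆ T ∪ aT` whenever `a ∉ T ∪ (−T)`. -/
def IsRigid {F : Type*} [Field F] (T : Set F) : Prop :=
  ∀ a : F, a ≠ 0 → a ∉ T → -a ∉ T → sumSet T a ⊆ T ∪ scaleSet a T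

/-- Let A be a valuation ring of F with residue field k of characteristic not 2, π the
residue map.  If T₀ is a subgroup of kˣ containing the nonzero squares with −1 ∉ T₀ and
−1 ∈ T₀ + T₀, and T = (Fˣ)²·π⁻¹(T₀), then −1 ∉ T and −1 ∈ T + T, i.e. T has level 2. -/
theorem level_two_of_residue_level_two {F : Type*} [Field F] (A : ValuationSubring F)
    (hk2 : (2 : IsLocalRing.ResidueField A) ≠ 0)
    (T₀ : Set (IsLocalRing.ResidueField A))
    (h0 : (0 : IsLocalRing.ResidueField A) ∉ T₀)
    (hmul : ∀ a ∈ T₀, ∀ b ∈ T₀, a * b ∈ T₀)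
    (hinv : ∀ a ∈ T₀, a⁻¹ ∈ T₀)
    (hsq : ∀ y : IsLocalRing.ResidueField A, y ≠ 0 → y ^ 2 ∈ T₀)
    (hneg : (-1 : IsLocalRing.ResidueField A) ∉ T₀)
    (hlev : ∃ s ∈ T₀, ∃ t ∈ T₀, s + t = -1) :
    (-1 : F) ∉ {x : F | ∃ (f : F) (u : A), f ≠ 0 ∧ IsUnit u ∧
        IsLocalRing.residue A u ∈ T₀ ∧ x = f ^ 2 * u} ∧
      ∃ s ∈ {x : F | ∃ (f : F) (u : A), f ≠ 0 ∧ IsUnit u ∧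
        IsLocalRing.residue A u ∈ T₀ ∧ x = f ^ 2 * u},
      ∃ t ∈ {x : F | ∃ (f : F) (u : A), f ≠ 0 ∧ IsUnit u ∧
        IsLocalRing.residue A u ∈ T₀ ∧ x = f ^ 2 * u},
      s + t = (-1 : F) := by
  have key : ∀ a : A, IsLocalRing.residue A a ∈ T₀ → (a : F) ∈ {x : F | ∃ (f : F) (u : A),
      f ≠ 0 ∧ IsUnit u ∧ IsLocalRing.residue A u ∈ T₀ ∧ x = f ^ 2 * u} := by
    intro a ha
    refine ⟨1, a, one_ne_zero, ?_, ha, by ring⟩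
    rw [← IsLocalRing.residue_ne_zero_iff_isUnit]
    intro h
    exact h0 (h ▸ ha)
  constructor
  · rintro ⟨f, u, hf, hu, huT, h⟩
    rcases A.mem_or_inv_mem f with hA | hA
    · have e : (-1 : A) = (⟨f, hA⟩ : A) ^ 2 * u := Subtype.ext (by simpa using h)
      have e2 := congrArg (IsLocalRing.residue A) e
      simp only [map_neg, map_one, map_mul, map_pow] at e2
      apply hneg
      rw [e2]
      refine hmul _ (hsq _ ?_) _ huT
      intro hz
      rw [hz] at e2
      simp at e2
    · have e : u = -(⟨f⁻¹, hA⟩ : A) ^ 2 := Subtype.ext (by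
        have : (u : F) = -(f⁻¹) ^ 2 := by
          field_simp
          linear_combination -h
        simpa using this)
      have e2 := congrArg (IsLocalRing.residue A) e
      simp only [map_neg, map_pow] at e2
      have hz : IsLocalRing.residue A (⟨f⁻¹, hA⟩ : A) ≠ 0 := by
        intro hz
        rw [hz] at e2
        apply h0
        have e3 : IsLocalRing.residue A u = 0 := by simpa using e2
        exact e3 ▸ huT
      apply hneg
      have e4 := hmul _ huT _ (hinv _ (hsq _ hz))
      rw [e2, neg_mul, mul_inv_cancel₀ (pow_ne_zero 2 hz)] at e4
      exact e4
  · obtain ⟨s, hs, t, ht, hst⟩ := hlev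
    obtain ⟨a, rfl⟩ := IsLocalRing.residue_surjective s
    refine ⟨a, key a hs, ((-1 - a : A) : F), key _ ?_, ?_⟩
    · have : IsLocalRing.residue A (-1 - a) = t := by
        rw [map_sub, map_neg, map_one, ← hst]
        ring
      rw [this]
      exact ht
    · push_cast
      ring
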